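/- Let G be a finite abelian group of order q ≥ 2 and let 0 < p < (q−1)/q. Let W be the depolarizing distribution on G (W(0) = 1−p, W(x) = p/(q−1) for x ≠ 0), and define the base-q W-weight |x|_W = −log_q Σ_{e∈G} √(W(e)·W(e−x)). Then for every r ∈ [0,1], the minimum of Σ_{x∈G} P(x)|x|_W over all probability distributions P on G with H_q(P) ≥ 1 − r equals −δ_GV(r)·log_q γ_q(p). -/

import Mathlib

/-!
STATEMENT 12: for the depolarizing distribution,
`min { ∑_x P(x)|x|_W : H_q(P) ≥ 1 − r } = −δ_GV(r) · log_q γ_q(p)`,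
where `|x|_W = −log_q ∑_e √(W(e)W(e−x))` and `δ_GV(r)` is the unique
`t ∈ [0,(q−1)/q]` with `h_q(t) = 1 − r`.
-/

open scoped BigOperators

/-- Base-`q` entropy of a distribution on `X`. -/
noncomputable def entropyBase (q : ℕ) {X : Type*} [Fintype X] (P : X → ℝ) : ℝ :=
  -∑ x, P x * Real.logb q (P x)

/-- The `q`-ary entropy function
`h_q(t) = t log_q(q−1) − t log_q t − (1−t) log_q (1−t)`. -/
noncomputable def qaryEntropy (q : ℕ) (t : ℝ) : ℝ :=
  t * Real.logb q ((q : ℝ) - 1) - t * Real.logb q t - (1 - t) * Real.logb q (1 - t)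

theorem entropyBase_eq_sum_negMulLog (q : ℕ) {X : Type*} [Fintype X] (P : X → ℝ) :
    entropyBase q P = (∑ x, Real.negMulLog (P x)) / Real.log q := by
  simp only [entropyBase, Real.negMulLog, Real.logb, ← Finset.sum_neg_distrib, Finset.sum_div]
  exact Finset.sum_congr rfl fun x _ ↦ by ring

theorem qaryEntropy_eq_div_log (q : ℕ) (t : ℝ) :
    qaryEntropy q t = Real.qaryEntropy q t / Real.log q := by
  simp only [qaryEntropy, Real.qaryEntropy, Real.binEntropy_eq_negMulLog_add_negMulLog_one_sub,
    Real.negMulLog, Real.logb]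
  push_cast
  ring

theorem mul_negMulLog_div {n : ℝ} (hn : n ≠ 0) (s : ℝ) :
    n * Real.negMulLog (s / n) = Real.negMulLog s + s * Real.log n := by
  rw [div_eq_mul_inv, Real.negMulLog_mul]
  simp only [Real.negMulLog, Real.log_inv]
  field_simp

/-- A finite sum of `negMulLog` is largest at the uniform vector with the same sum. -/
theorem sum_negMulLog_le {ι : Type*} {A : Finset ι} (hA : A.Nonempty) {P : ι → ℝ}
    (hP : ∀ x ∈ A, 0 ≤ P x) :
    ∑ x ∈ A, Real.negMulLog (P x) ≤
      Real.negMulLog (∑ x ∈ A, P x) + (∑ x ∈ A, P x) * Real.log A.card := by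
  have hn : (0 : ℝ) < A.card := by exact_mod_cast hA.card_pos
  have h := Real.concaveOn_negMulLog.le_map_sum (t := A) (w := fun _ ↦ (A.card : ℝ)⁻¹) (p := P)
    (fun _ _ ↦ by positivity) (by simp [hn.ne']) hP
  simp only [smul_eq_mul, ← Finset.mul_sum] at h
  rw [← mul_negMulLog_div hn.ne', div_eq_inv_mul]
  calc _ = A.card * ((A.card : ℝ)⁻¹ * ∑ x ∈ A, Real.negMulLog (P x)) := by field_simp
    _ ≤ _ := by gcongr

theorem card_erase_zero_cast {G : Type*} [AddCommGroup G] [Fintype G] [DecidableEq G] :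
    (((Finset.univ.erase (0 : G)).card : ℕ) : ℝ) = (Fintype.card G : ℝ) - 1 := by
  rw [Finset.card_erase_of_mem (Finset.mem_univ _), Finset.card_univ,
    Nat.cast_sub Fintype.card_pos, Nat.cast_one]

/-- Fano's inequality: the entropy of `P` is at most the `q`-ary entropy of its mass off `0`. -/
theorem sum_negMulLog_le_qaryEntropy {G : Type*} [AddCommGroup G] [Fintype G] [DecidableEq G]
    [Nontrivial G] {P : G → ℝ} (hP : ∀ x, 0 ≤ P x) (hsum : ∑ x, P x = 1) :
    ∑ x, Real.negMulLog (P x) ≤ Real.qaryEntropy (Fintype.card G) (1 - P 0) := by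
  have hs : ∑ x ∈ Finset.univ.erase (0 : G), P x = 1 - P 0 := by
    rw [← hsum, ← Finset.add_sum_erase _ P (Finset.mem_univ (0 : G))]
    ring
  obtain ⟨y, hy⟩ := exists_ne (0 : G)
  have h := sum_negMulLog_le (A := Finset.univ.erase (0 : G)) ⟨y, by simpa using hy⟩
    (P := P) fun x _ ↦ hP x
  rw [hs, card_erase_zero_cast] at h
  rw [← Finset.add_sum_erase _ _ (Finset.mem_univ (0 : G)), Real.qaryEntropy,
    Real.binEntropy_eq_negMulLog_add_negMulLog_one_sub, sub_sub_cancel]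
  push_cast
  linarith

/-- A function on `G` that is constant off `0` has an explicit sum. -/
theorem sum_ite_eq_zero {G : Type*} [AddCommGroup G] [Fintype G] [DecidableEq G] (a b : ℝ) :
    ∑ x : G, (if x = 0 then a else b) = a + ((Fintype.card G : ℝ) - 1) * b := by
  rw [← Finset.add_sum_erase _ _ (Finset.mem_univ (0 : G)), if_pos rfl,
    Finset.sum_congr rfl fun x hx ↦ if_neg (Finset.ne_of_mem_erase hx), Finset.sum_const,
    nsmul_eq_mul, card_erase_zero_cast]

/-- The depolarizing distribution has Fano's inequality as an equality. -/
theorem sum_negMulLog_ite_eq_qaryEntropy {G : Type*} [AddCommGroup G] [Fintype G] [DecidableEq G]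
    [Nontrivial G] (t : ℝ) :
    ∑ x : G, Real.negMulLog (if x = 0 then 1 - t else t / ((Fintype.card G : ℝ) - 1)) =
      Real.qaryEntropy (Fintype.card G) t := by
  have hn : (Fintype.card G : ℝ) - 1 ≠ 0 := by
    have : (1 : ℝ) < Fintype.card G := by exact_mod_cast Fintype.one_lt_card
    linarith
  simp only [apply_ite Real.negMulLog]
  rw [sum_ite_eq_zero, mul_negMulLog_div hn, Real.qaryEntropy,
    Real.binEntropy_eq_negMulLog_add_negMulLog_one_sub]
  push_cast
  ring

theorem sum_sqrt_depolarizing_mul_shift {G : Type*} [AddCommGroup G] [Fintype G] [DecidableEq G]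
    {a b : ℝ} (hb : 0 ≤ b) {W : G → ℝ} (hW : ∀ x, W x = if x = 0 then a else b)
    {x : G} (hx : x ≠ 0) :
    ∑ e, Real.sqrt (W e * W (e - x)) =
      ((Fintype.card G : ℝ) - 2) * b + 2 * Real.sqrt (a * b) := by
  have h : ∀ e, Real.sqrt (W e * W (e - x)) =
      b + (if e = 0 then Real.sqrt (a * b) - b else 0) +
        (if e = x then Real.sqrt (a * b) - b else 0) := by
    intro e
    by_cases h0 : e = 0
    · subst h0
      simp [hW, hx, hx.symm]
    · by_cases h1 : e = x
      · subst h1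
        simp [hW, h0, mul_comm]
      · simp [hW, h0, h1, sub_eq_zero, Real.sqrt_mul_self hb]
  simp only [h, Finset.sum_add_distrib, Finset.sum_ite_eq', Finset.mem_univ, if_true,
    Finset.sum_const, Finset.card_univ, nsmul_eq_mul]
  ring

theorem sum_sqrt_mul_self_eq_one {X : Type*} [Fintype X] {W : X → ℝ} (hW : ∀ x, 0 ≤ W x)
    (hsum : ∑ x, W x = 1) : ∑ x, Real.sqrt (W x * W x) = 1 := by
  rw [← hsum]
  exact Finset.sum_congr rfl fun x _ ↦ Real.sqrt_mul_self (hW x)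

theorem depolarizing_expurgation_weight_min
    (G : Type) [AddCommGroup G] [Fintype G] [DecidableEq G]
    (q : ℕ) (hq : Fintype.card G = q) (hq2 : 2 ≤ q)
    (p : ℝ) (hp0 : 0 < p) (hp1 : p < ((q : ℝ) - 1) / q)
    (W : G → ℝ) (hW : ∀ x, W x = if x = 0 then 1 - p else p / ((q : ℝ) - 1))
    (r : ℝ) (hr : r ∈ Set.Icc (0 : ℝ) 1)
    (t : ℝ) (ht : t ∈ Set.Icc (0 : ℝ) (((q : ℝ) - 1) / q))
    (hth : qaryEntropy q t = 1 - r) :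
    sInf {s : ℝ | ∃ P : G → ℝ,
        (∀ x, 0 ≤ P x) ∧ (∑ x, P x) = 1 ∧ 1 - r ≤ entropyBase q P ∧
        s = ∑ x, P x * (-Real.logb q (∑ e, Real.sqrt (W e * W (e - x))))} =
      -t * Real.logb q
        (p * ((q : ℝ) - 2) / ((q : ℝ) - 1) + 2 * Real.sqrt (p * (1 - p) / ((q : ℝ) - 1))) := by
  subst hq
  set n : ℝ := (Fintype.card G : ℝ) with hn
  set γ := p * (n - 2) / (n - 1) + 2 * Real.sqrt (p * (1 - p) / (n - 1)) with hγ
  have hn2 : (2 : ℝ) ≤ n := by rw [hn]; exact_mod_cast hq2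
  have hn1 : 0 < n - 1 := by linarith
  have hlog : 0 < Real.log n := Real.log_pos (by linarith)
  have : Nontrivial G := Fintype.one_lt_card_iff_nontrivial.mp hq2
  have hfrac : (n - 1) / n < 1 := by rw [div_lt_one] <;> linarith
  have hp : 0 < 1 - p := by linarith
  have hb : 0 ≤ p / (n - 1) := by positivity
  have hγ0 : 0 ≤ γ := by
    have : 0 ≤ n - 2 := by linarith
    positivity
  have hγ1 : γ ≤ 1 := by
    have h1 : p * (1 - p) / (n - 1) = (1 - p) * (p / (n - 1)) := by ring
    have h2 := two_mul_le_add_sq (Real.sqrt (1 - p)) (Real.sqrt (p / (n - 1)))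
    rw [Real.sq_sqrt hp.le, Real.sq_sqrt hb, mul_assoc, ← Real.sqrt_mul hp.le, ← h1] at h2
    have h3 : p * (n - 2) / (n - 1) = p - p / (n - 1) := by field_simp; ring
    rw [hγ, h3]
    linarith
  have hc : 0 ≤ -Real.logb n γ := by
    rw [Real.logb, ← neg_div]
    exact div_nonneg (neg_nonneg.mpr (Real.log_nonpos hγ0 hγ1)) hlog.le
  have hweight : ∀ x, -Real.logb n (∑ e, Real.sqrt (W e * W (e - x))) =
      if x = 0 then 0 else -Real.logb n γ := by
    intro x
    split_ifs with hx
    · subst hx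
      simp only [sub_zero]
      rw [sum_sqrt_mul_self_eq_one]
      · simp
      · intro x
        rw [hW]
        split_ifs <;> positivity
      · simp only [hW]
        rw [sum_ite_eq_zero]
        field_simp
        ring
    · rw [sum_sqrt_depolarizing_mul_shift hb hW hx, hγ]
      congr 3
      · ring
      · ring_nf
  have hobj : ∀ P : G → ℝ, ∑ x, P x = 1 →
      ∑ x, P x * (-Real.logb n (∑ e, Real.sqrt (W e * W (e - x)))) =
        (1 - P 0) * -Real.logb n γ := by
    intro P hP
    have : ∀ x, P x * (if x = 0 then 0 else -Real.logb n γ) =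
        P x * -Real.logb n γ - if x = 0 then P x * -Real.logb n γ else 0 := by
      intro x
      split_ifs <;> ring
    simp only [hweight, this, Finset.sum_sub_distrib, Finset.sum_ite_eq', Finset.mem_univ, if_true,
      ← Finset.sum_mul, hP]
    ring
  refine IsLeast.csInf_eq ⟨?_, ?_⟩
  · have hsum : ∑ x : G, (if x = 0 then 1 - t else t / (n - 1)) = 1 := by
      rw [sum_ite_eq_zero]
      field_simp
      ring
    refine ⟨fun x ↦ if x = 0 then 1 - t else t / (n - 1), fun x ↦ ?_, hsum, ?_, ?_⟩
    · have := ht.1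
      have := ht.2
      dsimp only
      split_ifs
      · linarith
      · positivity
    · rw [entropyBase_eq_sum_negMulLog, sum_negMulLog_ite_eq_qaryEntropy, ← hth,
        qaryEntropy_eq_div_log]
    · rw [hobj _ hsum, if_pos rfl]
      ring
  · rintro s ⟨P, hP, hsum, hent, rfl⟩
    rw [hobj P hsum, neg_mul_comm]
    refine mul_le_mul_of_nonneg_right ?_ hc
    by_contra! hlt
    have hP0 : P 0 ≤ 1 := hsum ▸ Finset.single_le_sum (fun x _ ↦ hP x) (Finset.mem_univ 0)
    have hset : (n - 1) / n = 1 - 1 / n := by field_simp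
    have hmono := Real.qaryEntropy_strictMonoOn hq2 (a := 1 - P 0) (b := t)
      ⟨by linarith, by rw [← hn, ← hset]; linarith [ht.2]⟩
      ⟨ht.1, by rw [← hn, ← hset]; exact ht.2⟩ hlt
    rw [← hth, qaryEntropy_eq_div_log, entropyBase_eq_sum_negMulLog,
      div_le_div_iff_of_pos_right hlog] at hent
    linarith [sum_negMulLog_le_qaryEntropy hP hsum]
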